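/- arXiv:2306.06695 — 2 statements merged into one kernel-verified Lean document; each statement's English description precedes it below -/
import Mathlib

section
/- For any non-trivial bicolouring of the convex m-gon P_m (m ≥ 4), every set of m−4 pairwise non-crossing permitted diagonals is contained in at least one and at most two permissible triangulations. -/
/-!
Vertices of the convex `m`-gon `P_m` are identified with `ZMod m` in cyclic order.
Blue is encoded by the Boolean value `true`, red by `false`.
-/

namespace Poly

/-- A diagonal of `P_m`: an unordered pair `{i, j}` of vertices with
`j - i ≢ 0, 1, -1 (mod m)`. -/
def IsDiag (m : ℕ) (e : Sym2 (ZMod m)) : Prop :=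
  ∃ i j : ZMod m, e = s(i, j) ∧ j - i ≠ 0 ∧ j - i ≠ 1 ∧ j - i ≠ -1

/-- `x` lies in the open cyclic interval from `a` to `b` (going in the positive
cyclic direction). -/
def StrictBtw (m : ℕ) (a x b : ZMod m) : Prop :=
  0 < (x - a).val ∧ (x - a).val < (b - a).val

/-- Two diagonals `{a,b}` and `{c,d}` cross: their four endpoints are distinct and
exactly one of `c`, `d` lies in the open cyclic interval from `a` to `b`. -/
def Cross (m : ℕ) (e f : Sym2 (ZMod m)) : Prop :=
  ∃ a b c d : ZMod m, e = s(a, b) ∧ f = s(c, d) ∧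
    a ≠ b ∧ a ≠ c ∧ a ≠ d ∧ b ≠ c ∧ b ≠ d ∧ c ≠ d ∧
    Xor' (StrictBtw m a c b) (StrictBtw m a d b)

/-- A triangulation of `P_m`: a set of `m - 3` pairwise non-crossing diagonals. -/
def IsTriangulation (m : ℕ) (T : Finset (Sym2 (ZMod m))) : Prop :=
  T.card = m - 3 ∧ (∀ e ∈ T, IsDiag m e) ∧
    ∀ e ∈ T, ∀ f ∈ T, e ≠ f → ¬ Cross m e f

/-- A bicolouring: a function from the vertices to {red, blue} attaining both values
(`true` = blue, `false` = red). -/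
def IsBicolouring (m : ℕ) (c : ZMod m → Bool) : Prop :=
  (∃ v, c v = true) ∧ (∃ v, c v = false)

/-- A bicolouring is non-trivial if some diagonal has both endpoints red. -/
def IsNontrivialBicolouring (m : ℕ) (c : ZMod m → Bool) : Prop :=
  IsBicolouring m c ∧ ∃ i j : ZMod m, IsDiag m s(i, j) ∧ c i = false ∧ c j = false

/-- A diagonal is permitted if at least one of its endpoints is blue. -/
def Permitted (m : ℕ) (c : ZMod m → Bool) (e : Sym2 (ZMod m)) : Prop :=
  ∃ v ∈ e, c v = true

/-- A permissible triangulation: a triangulation all of whose diagonals are permitted. -/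
def IsPermissible (m : ℕ) (c : ZMod m → Bool) (T : Finset (Sym2 (ZMod m))) : Prop :=
  IsTriangulation m T ∧ ∀ e ∈ T, Permitted m c e

/-- Two permissible triangulations are joined in the flip graph of permissible
triangulations: there is a finite sequence of permissible triangulations from one to the
other in which consecutive triangulations share exactly `m - 4` diagonals. -/
def PermFlipJoined (m : ℕ) (c : ZMod m → Bool) (T₁ T₂ : Finset (Sym2 (ZMod m))) : Prop :=
  ∃ n : ℕ, ∃ f : Fin (n + 1) → Finset (Sym2 (ZMod m)),
    f 0 = T₁ ∧ f (Fin.last n) = T₂ ∧ (∀ i, IsPermissible m c (f i)) ∧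
    ∀ i : Fin n, (f i.castSucc ∩ f i.succ).card = m - 4

/-- The chord `e` of the linearly ordered vertices starts before `f` and crosses it. -/
def CrossBefore (e f : ℕ × ℕ) : Prop := e.1 < f.1 ∧ f.1 < e.2 ∧ e.2 < f.2

/-- `F` is a family of pairwise non-crossing chords of the polygon with vertices `x, …, y`
that contains all the sides of this polygon. -/
structure IsDissection (x y : ℕ) (F : Finset (ℕ × ℕ)) : Prop where
  mem_bounds : ∀ e ∈ F, x ≤ e.1 ∧ e.1 < e.2 ∧ e.2 ≤ y
  base_mem : (x, y) ∈ F
  unit_mem : ∀ i, x ≤ i → i < y → (i, i + 1) ∈ F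
  not_cross : ∀ e ∈ F, ∀ f ∈ F, ¬ CrossBefore e f

/-- A dissection is cut by its longest chord `(x, z)` other than the base. -/
theorem IsDissection.exists_split {x y : ℕ} {F : Finset (ℕ × ℕ)} (h : IsDissection x y F)
    (hxy : x + 1 < y) :
    ∃ z, x < z ∧ z < y ∧ (x, z) ∈ F ∧ (∀ w, z < w → w < y → (x, w) ∉ F) ∧
      IsDissection x z (F.filter fun e => e.2 ≤ z) ∧
      IsDissection z y (insert (z, y) (F.filter fun e => z ≤ e.1)) ∧
      F.card = 1 + (F.filter fun e => e.2 ≤ z).card + (F.filter fun e => z ≤ e.1).card := by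
  obtain ⟨z, hz, hmax⟩ := Finset.exists_max_image
    ((Finset.range y).filter fun w => (x, w) ∈ F) id
    ⟨x + 1, by simp [hxy, h.unit_mem x le_rfl (by omega)]⟩
  simp only [Finset.mem_filter, Finset.mem_range, id] at hz hmax
  obtain ⟨hzy, hzF⟩ := hz
  have hxz := (h.mem_bounds _ hzF).2.1
  simp only at hxz
  have hmax' : ∀ w, z < w → w < y → (x, w) ∉ F := fun w h1 h2 h3 => by
    have := hmax w ⟨h2, h3⟩; omega
  refine ⟨z, hxz, hzy, hzF, hmax', ?_, ?_, ?_⟩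
  · refine ⟨fun e he => ?_, by simp [hzF], fun i hi hi' => ?_, fun e he f hf => ?_⟩
    · rw [Finset.mem_filter] at he
      have := h.mem_bounds e he.1
      omega
    · rw [Finset.mem_filter]
      exact ⟨h.unit_mem i hi (by omega), hi'⟩
    · exact h.not_cross e (Finset.mem_filter.1 he).1 f (Finset.mem_filter.1 hf).1
  · have hb : ∀ e ∈ insert (z, y) (F.filter fun e => z ≤ e.1), z ≤ e.1 ∧ e.1 < e.2 ∧ e.2 ≤ y := by
      intro e he
      rw [Finset.mem_insert, Finset.mem_filter] at he
      rcases he with rfl | he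
      · simp [hzy]
      · have := h.mem_bounds e he.1
        omega
    refine ⟨hb, by simp, fun i hi hi' => ?_, fun e he f hf hcr => ?_⟩
    · rw [Finset.mem_insert, Finset.mem_filter]
      exact Or.inr ⟨h.unit_mem i (by omega) hi', hi⟩
    · have he' := hb e he
      have hf' := hb f hf
      unfold CrossBefore at hcr
      rw [Finset.mem_insert, Finset.mem_filter] at he hf
      rcases he with rfl | he
      · simp only at *; omega
      · rcases hf with rfl | hf
        · simp only at *; omega
        · exact h.not_cross e he.1 f hf.1 hcr
  · have hF : F = insert (x, y) ((F.filter fun e => e.2 ≤ z) ∪ (F.filter fun e => z ≤ e.1)) := by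
      ext ⟨a, b⟩
      simp only [Finset.mem_insert, Finset.mem_union, Finset.mem_filter, Prod.mk.injEq]
      constructor
      · intro he
        have h1 := h.mem_bounds _ he
        have h2 := h.not_cross _ he _ hzF
        have h3 := h.not_cross _ hzF _ he
        unfold CrossBefore at h2 h3
        simp only at h1 h2 h3
        have h4 : ¬ (a = x ∧ z < b ∧ b < y) := by
          rintro ⟨rfl, h5, h6⟩
          exact hmax' b h5 h6 he
        by_cases h5 : b ≤ z
        · exact Or.inr (Or.inl ⟨he, h5⟩)
        · by_cases h6 : z ≤ a
          · exact Or.inr (Or.inr ⟨he, h6⟩)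
          · left; omega
      · rintro (⟨rfl, rfl⟩ | he | he)
        · exact h.base_mem
        · exact he.1
        · exact he.1
    have hdisj : Disjoint (F.filter fun e => e.2 ≤ z) (F.filter fun e => z ≤ e.1) := by
      rw [Finset.disjoint_left]
      intro e he hf
      rw [Finset.mem_filter] at he hf
      have := h.mem_bounds e he.1
      omega
    conv_lhs => rw [hF]
    rw [Finset.card_insert_of_notMem, Finset.card_union_of_disjoint hdisj]
    · omega
    · simp only [Finset.mem_union, Finset.mem_filter]
      omega

theorem IsDissection.lt {x y : ℕ} {F : Finset (ℕ × ℕ)} (h : IsDissection x y F) : x < y :=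
  (h.mem_bounds _ h.base_mem).2.1

theorem IsDissection.card_lt {x y : ℕ} {F : Finset (ℕ × ℕ)} (h : IsDissection x y F) :
    F.card + 2 * x < 2 * y := by
  induction hn : y - x using Nat.strong_induction_on generalizing x y F with
  | _ n ih =>
    have hlt := h.lt
    by_cases hxy : x + 1 < y
    · obtain ⟨z, hxz, hzy, -, -, h1, h2, hcard⟩ := h.exists_split hxy
      have c1 := ih _ (by omega) h1 rfl
      have c2 := ih _ (by omega) h2 rfl
      have := Finset.card_le_card (Finset.subset_insert (z, y) (F.filter fun e => z ≤ e.1))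
      omega
    · have : F ⊆ {(x, y)} := by
        rintro ⟨a, b⟩ he
        have := h.mem_bounds _ he
        simp only [Finset.mem_singleton, Prod.mk.injEq] at *
        omega
      have := Finset.card_le_card this
      rw [Finset.card_singleton] at this
      omega

/-- A dissection with one chord less than a triangulation has a quadrilateral face. -/
theorem IsDissection.exists_quadrilateral {x y : ℕ} {F : Finset (ℕ × ℕ)}
    (h : IsDissection x y F) (hF : F.card + 2 * x + 2 = 2 * y) :
    ∃ p q r s, p < q ∧ q < r ∧ r < s ∧ (p, q) ∈ F ∧ (q, r) ∈ F ∧ (r, s) ∈ F ∧ (p, s) ∈ F ∧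
      (p, r) ∉ F ∧ (q, s) ∉ F := by
  induction hn : y - x using Nat.strong_induction_on generalizing x y F with
  | _ n ih =>
    have hlt := h.lt
    have hpos : 0 < F.card := Finset.card_pos.2 ⟨_, h.base_mem⟩
    obtain ⟨z, hxz, hzy, hzF, hmax, h1, h2, hcard⟩ := h.exists_split (by omega)
    have c1 := h1.card_lt
    have c2 := h2.card_lt
    by_cases hz : (z, y) ∈ F
    · have hins : insert (z, y) (F.filter fun e => z ≤ e.1) = F.filter fun e => z ≤ e.1 :=
        Finset.insert_eq_of_mem (by simp [hz])
      rw [hins] at h2 c2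
      by_cases hd : (F.filter fun e => e.2 ≤ z).card + 2 * x + 2 = 2 * z
      · obtain ⟨p, q, r, s, hpq, hqr, hrs, m1, m2, m3, m4, m5, m6⟩ := ih _ (by omega) h1 hd rfl
        simp only [Finset.mem_filter] at m1 m2 m3 m4 m5 m6
        exact ⟨p, q, r, s, hpq, hqr, hrs, m1.1, m2.1, m3.1, m4.1,
          fun hm => m5 ⟨hm, by omega⟩, fun hm => m6 ⟨hm, by omega⟩⟩
      · obtain ⟨p, q, r, s, hpq, hqr, hrs, m1, m2, m3, m4, m5, m6⟩ :=
          ih _ (by omega) h2 (by omega) rfl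
        simp only [Finset.mem_filter] at m1 m2 m3 m4 m5 m6
        exact ⟨p, q, r, s, hpq, hqr, hrs, m1.1, m2.1, m3.1, m4.1,
          fun hm => m5 ⟨hm, by omega⟩, fun hm => m6 ⟨hm, by omega⟩⟩
    · have hzy' : z + 1 < y := by
        rcases Nat.lt_or_ge (z + 1) y with h' | h'
        · exact h'
        · obtain rfl : y = z + 1 := by omega
          exact absurd (h.unit_mem z (by omega) (by omega)) hz
      have c3 := Finset.card_insert_of_notMem
        (show (z, y) ∉ F.filter fun e => z ≤ e.1 by simp [hz])
      obtain ⟨w, hzw, hwy, hwF, -, k1, k2, kcard⟩ := h2.exists_split hzy'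
      have d1 := k1.card_lt
      have d2 := k2.card_lt
      have hw : (w, y) ∈ (insert (z, y) (F.filter fun e => z ≤ e.1)).filter fun e => w ≤ e.1 := by
        by_contra hw
        rw [Finset.card_insert_of_notMem hw] at d2
        omega
      refine ⟨x, z, w, y, hxz, hzw, hwy, hzF, ?_, ?_, h.base_mem, hmax w hzw hwy, hz⟩
      · simp only [Finset.mem_insert, Finset.mem_filter, Prod.mk.injEq] at hwF
        rcases hwF with hwF | hwF
        · omega
        · exact hwF.1
      · simp only [Finset.mem_insert, Finset.mem_filter, Prod.mk.injEq] at hw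
        rcases hw with ⟨hw | hw, -⟩
        · omega
        · exact hw.1

/-- Inserting a chord that crosses no chord of a dissection yields a dissection. -/
theorem IsDissection.insert {x y : ℕ} {F : Finset (ℕ × ℕ)} (h : IsDissection x y F) {e : ℕ × ℕ}
    (hb : x ≤ e.1 ∧ e.1 < e.2 ∧ e.2 ≤ y)
    (he : ∀ f ∈ F, ¬ CrossBefore e f ∧ ¬ CrossBefore f e) :
    IsDissection x y (insert e F) := by
  refine ⟨fun f hf => ?_, Finset.mem_insert_of_mem h.base_mem,
    fun i hi hi' => Finset.mem_insert_of_mem (h.unit_mem i hi hi'), fun f hf g hg => ?_⟩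
  · rcases Finset.mem_insert.1 hf with rfl | hf
    · exact hb
    · exact h.mem_bounds f hf
  · obtain hf' | hf' := Finset.mem_insert.1 hf <;> obtain hg' | hg' := Finset.mem_insert.1 hg
    · subst hf' hg'
      unfold CrossBefore
      omega
    · exact hf' ▸ (he g hg').1
    · exact hg' ▸ (he f hf').2
    · exact h.not_cross f hf' g hg'

theorem eq_of_crossBefore_diagonal {p q r s : ℕ} {e : ℕ × ℕ} (hpq : p < q) (hqr : q < r)
    (hrs : r < s)
    (h1 : ¬ CrossBefore e (p, q) ∧ ¬ CrossBefore (p, q) e)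
    (h2 : ¬ CrossBefore e (q, r) ∧ ¬ CrossBefore (q, r) e)
    (h3 : ¬ CrossBefore e (r, s) ∧ ¬ CrossBefore (r, s) e)
    (h4 : ¬ CrossBefore e (p, s) ∧ ¬ CrossBefore (p, s) e) :
    (CrossBefore e (p, r) ∨ CrossBefore (p, r) e → e = (q, s)) ∧
      (CrossBefore e (q, s) ∨ CrossBefore (q, s) e → e = (p, r)) := by
  obtain ⟨a, b⟩ := e
  simp only [CrossBefore, Prod.mk.injEq] at *
  omega

/-- A dissection with one chord less than a triangulation has a quadrilateral face, whose
diagonals are the only chords that can be added. -/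
theorem IsDissection.exists_quadrilateral_iff {x y : ℕ} {F : Finset (ℕ × ℕ)}
    (h : IsDissection x y F) (hF : F.card + 2 * x + 2 = 2 * y) :
    ∃ p q r s, p < q ∧ q < r ∧ r < s ∧ (p, q) ∈ F ∧ (q, r) ∈ F ∧ (r, s) ∈ F ∧ (p, s) ∈ F ∧
      ∀ e : ℕ × ℕ, ((x ≤ e.1 ∧ e.1 < e.2 ∧ e.2 ≤ y) ∧ e ∉ F ∧
        ∀ f ∈ F, ¬ CrossBefore e f ∧ ¬ CrossBefore f e) ↔ e = (p, r) ∨ e = (q, s) := by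
  obtain ⟨p, q, r, s, hpq, hqr, hrs, m1, m2, m3, m4, m5, m6⟩ := h.exists_quadrilateral hF
  have hps := h.mem_bounds _ m4
  simp only at hps
  have key : ∀ e : ℕ × ℕ, (∀ f ∈ F, ¬ CrossBefore e f ∧ ¬ CrossBefore f e) →
      (CrossBefore e (p, r) ∨ CrossBefore (p, r) e → e = (q, s)) ∧
      (CrossBefore e (q, s) ∨ CrossBefore (q, s) e → e = (p, r)) := fun e he =>
    eq_of_crossBefore_diagonal hpq hqr hrs (he _ m1) (he _ m2) (he _ m3) (he _ m4)
  have hcF : ∀ f ∈ F, ∀ g ∈ F, ¬ CrossBefore f g ∧ ¬ CrossBefore g f := fun f hf g hg =>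
    ⟨h.not_cross f hf g hg, h.not_cross g hg f hf⟩
  have hpr : ∀ f ∈ F, ¬ CrossBefore (p, r) f ∧ ¬ CrossBefore f (p, r) := fun f hf => by
    have := (key f (hcF f hf)).1
    have h' : f ≠ (q, s) := fun h' => m6 (h' ▸ hf)
    tauto
  have hqs : ∀ f ∈ F, ¬ CrossBefore (q, s) f ∧ ¬ CrossBefore f (q, s) := fun f hf => by
    have := (key f (hcF f hf)).2
    have h' : f ≠ (p, r) := fun h' => m5 (h' ▸ hf)
    tauto
  refine ⟨p, q, r, s, hpq, hqr, hrs, m1, m2, m3, m4, fun e => ⟨?_, ?_⟩⟩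
  · rintro ⟨hb, heF, he⟩
    by_contra! hne
    have h1 := h.insert (e := (p, r)) (by simp only; omega) hpr
    have h2 := h1.insert hb fun f hf => by
      rcases Finset.mem_insert.1 hf with rfl | hf
      · have := (key e he).1
        tauto
      · exact he f hf
    have := h2.card_lt
    rw [Finset.card_insert_of_notMem (by simp [heF, hne.1]), Finset.card_insert_of_notMem m5]
      at this
    omega
  · rintro (rfl | rfl)
    · exact ⟨by simp only; omega, m5, hpr⟩
    · exact ⟨by simp only; omega, m6, hqs⟩

/-- The endpoints of a chord in increasing order. -/
def ends (m : ℕ) (e : Sym2 (ZMod m)) : ℕ × ℕ := ((e.map ZMod.val).inf, (e.map ZMod.val).sup)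

theorem ends_mk (m : ℕ) (i j : ZMod m) :
    ends m s(i, j) = (min i.val j.val, max i.val j.val) := by
  simp [ends]

theorem ends_natCast {m a b : ℕ} (hab : a < b) (hb : b < m) :
    ends m s((a : ZMod m), (b : ZMod m)) = (a, b) := by
  rw [ends_mk, ZMod.val_cast_of_lt hb, ZMod.val_cast_of_lt (by omega), min_eq_left hab.le,
    max_eq_right hab.le]

theorem ends_injective (m : ℕ) [NeZero m] : Function.Injective (ends m) := by
  intro e f
  induction e using Sym2.ind with | _ i j
  induction f using Sym2.ind with | _ k l
  rw [ends_mk, ends_mk, Prod.mk.injEq, Sym2.eq_iff]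
  intro h
  have : (i.val = k.val ∧ j.val = l.val) ∨ (i.val = l.val ∧ j.val = k.val) := by omega
  simpa only [(ZMod.val_injective m).eq_iff] using this

theorem ends_snd_lt {m : ℕ} [NeZero m] (e : Sym2 (ZMod m)) : (ends m e).2 < m := by
  induction e using Sym2.ind with | _ i j
  have := i.val_lt
  have := j.val_lt
  rw [ends_mk]
  omega

theorem val_sub_cases {m : ℕ} [NeZero m] (a b : ZMod m) :
    (b.val ≤ a.val ∧ (a - b).val + b.val = a.val) ∨
      (a.val < b.val ∧ (a - b).val + b.val = a.val + m) := by
  have h := ZMod.val_add_val_of_le (a := a - b) (b := b)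
  have h' := ZMod.val_add_of_lt (a := a - b) (b := b)
  rw [sub_add_cancel] at h h'
  have := a.val_lt
  have := (a - b).val_lt
  rcases Nat.lt_or_ge ((a - b).val + b.val) m with hlt | hge
  · have := h' hlt; omega
  · have := h hge; omega

theorem isDiag_iff {m : ℕ} (hm : 4 ≤ m) (e : Sym2 (ZMod m)) :
    IsDiag m e ↔ (ends m e).1 + 1 < (ends m e).2 ∧ ¬ ((ends m e).1 = 0 ∧ (ends m e).2 = m - 1) := by
  have : NeZero m := ⟨by omega⟩
  have : Fact (1 < m) := ⟨by omega⟩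
  have key : ∀ i j : ZMod m, (j - i ≠ 0 ∧ j - i ≠ 1 ∧ j - i ≠ -1) ↔
      (ends m s(i, j)).1 + 1 < (ends m s(i, j)).2 ∧
        ¬ ((ends m s(i, j)).1 = 0 ∧ (ends m s(i, j)).2 = m - 1) := by
    intro i j
    have h1 : j - i = -1 ↔ i - j = 1 := by rw [← neg_sub, neg_inj]
    rw [ne_eq (j - i) (-1), h1, ends_mk]
    simp only [ne_eq, ← (ZMod.val_injective m).eq_iff, ZMod.val_zero, ZMod.val_one]
    have := val_sub_cases i j
    have := val_sub_cases j i
    have := i.val_lt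
    have := j.val_lt
    omega
  constructor
  · rintro ⟨i, j, rfl, h⟩
    exact (key i j).1 h
  · induction e using Sym2.ind with | _ i j
    exact fun h => ⟨i, j, rfl, (key i j).2 h⟩

theorem cross_iff {m : ℕ} [NeZero m] (e f : Sym2 (ZMod m)) :
    Cross m e f ↔ CrossBefore (ends m e) (ends m f) ∨ CrossBefore (ends m f) (ends m e) := by
  have key : ∀ a b c d : ZMod m, (a ≠ b ∧ a ≠ c ∧ a ≠ d ∧ b ≠ c ∧ b ≠ d ∧ c ≠ d ∧
      Xor (StrictBtw m a c b) (StrictBtw m a d b)) ↔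
      CrossBefore (ends m s(a, b)) (ends m s(c, d)) ∨
        CrossBefore (ends m s(c, d)) (ends m s(a, b)) := by
    intro a b c d
    rw [ends_mk, ends_mk]
    simp only [ne_eq, ← (ZMod.val_injective m).eq_iff, StrictBtw, CrossBefore, Xor]
    have := val_sub_cases b a
    have := val_sub_cases c a
    have := val_sub_cases d a
    have := a.val_lt
    have := b.val_lt
    have := c.val_lt
    have := d.val_lt
    generalize (b - a).val = u at *
    generalize (c - a).val = v at *
    generalize (d - a).val = w at *
    generalize a.val = a' at *
    generalize b.val = b' at *
    generalize c.val = c' at *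
    generalize d.val = d' at *
    rcases le_total a' b' with h1 | h1 <;> rcases le_total c' d' with h2 | h2 <;>
      simp only [h1, h2, min_eq_left, min_eq_right, max_eq_left, max_eq_right] <;> omega
  constructor
  · rintro ⟨a, b, c, d, rfl, rfl, h⟩
    exact (key a b c d).1 h
  · induction e using Sym2.ind with | _ a b
    induction f using Sym2.ind with | _ c d
    exact fun h => ⟨a, b, c, d, rfl, rfl, (key a b c d).2 h⟩

/-- The chords in `S` and the sides of `P_m`, as pairs of natural numbers. -/
def chords (m : ℕ) (S : Finset (Sym2 (ZMod m))) : Finset (ℕ × ℕ) :=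
  insert (0, m - 1) ((Finset.range (m - 1)).image (fun i => (i, i + 1)) ∪ S.image (ends m))

theorem mem_chords {m : ℕ} {S : Finset (Sym2 (ZMod m))} {e : ℕ × ℕ} :
    e ∈ chords m S ↔ e = (0, m - 1) ∨ (e.1 < m - 1 ∧ e.2 = e.1 + 1) ∨ ∃ f ∈ S, ends m f = e := by
  obtain ⟨a, b⟩ := e
  simp only [chords, Finset.mem_insert, Finset.mem_union, Finset.mem_image, Finset.mem_range,
    Prod.mk.injEq]
  refine or_congr_right (or_congr_left ⟨?_, ?_⟩)
  · rintro ⟨i, hi, rfl, rfl⟩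
    exact ⟨hi, rfl⟩
  · rintro ⟨h, rfl⟩
    exact ⟨a, h, rfl, rfl⟩

theorem card_chords {m : ℕ} (hm : 4 ≤ m) {S : Finset (Sym2 (ZMod m))}
    (hS : ∀ e ∈ S, IsDiag m e) : (chords m S).card = S.card + m := by
  have : NeZero m := ⟨by omega⟩
  rw [chords, Finset.card_insert_of_notMem, Finset.card_union_of_disjoint,
    Finset.card_image_of_injective _ (ends_injective m), Finset.card_image_of_injective,
    Finset.card_range]
  · omega
  · exact fun i j h => (Prod.mk.inj h).1
  · rw [Finset.disjoint_left]
    intro e he hf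
    obtain ⟨i, -, rfl⟩ := Finset.mem_image.1 he
    obtain ⟨f, hf, h⟩ := Finset.mem_image.1 hf
    have := (isDiag_iff hm f).1 (hS f hf)
    rw [h] at this
    simp at this
  · intro he
    rcases Finset.mem_union.1 he with he | he
    · obtain ⟨i, -, h⟩ := Finset.mem_image.1 he
      rw [Prod.mk.injEq] at h
      omega
    · obtain ⟨f, hf, h⟩ := Finset.mem_image.1 he
      have := (isDiag_iff hm f).1 (hS f hf)
      rw [h] at this
      simp at this

theorem isDissection_chords {m : ℕ} (hm : 4 ≤ m) {S : Finset (Sym2 (ZMod m))}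
    (hS : ∀ e ∈ S, IsDiag m e) (hcr : ∀ e ∈ S, ∀ f ∈ S, e ≠ f → ¬ Cross m e f) :
    IsDissection 0 (m - 1) (chords m S) := by
  have : NeZero m := ⟨by omega⟩
  have hb : ∀ e ∈ chords m S, 0 ≤ e.1 ∧ e.1 < e.2 ∧ e.2 ≤ m - 1 := by
    intro e he
    rcases mem_chords.1 he with rfl | he | ⟨f, hf, rfl⟩
    · simp only; omega
    · omega
    · have := (isDiag_iff hm f).1 (hS f hf)
      have := ends_snd_lt f
      omega
  refine ⟨hb, mem_chords.2 (Or.inl rfl), fun i _ hi => mem_chords.2 (Or.inr (Or.inl ⟨hi, rfl⟩)),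
    fun e he f hf hef => ?_⟩
  have he' := hb e he
  have hf' := hb f hf
  rcases mem_chords.1 he with rfl | he | ⟨e, heS, rfl⟩
  · simp only [CrossBefore] at *; omega
  · simp only [CrossBefore] at *; omega
  rcases mem_chords.1 hf with rfl | hf | ⟨f, hfS, rfl⟩
  · simp only [CrossBefore] at *; omega
  · simp only [CrossBefore] at *; omega
  refine hcr e heS f hfS ?_ ((cross_iff e f).2 (Or.inl hef))
  rintro rfl
  simp only [CrossBefore] at hef
  omega

/-- The chords that can be added to the dissection given by `S` are the diagonals outside `S`
that cross no element of `S`. -/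
theorem addable_iff {m : ℕ} (hm : 4 ≤ m) {S : Finset (Sym2 (ZMod m))}
    (d : Sym2 (ZMod m)) :
    ((0 ≤ (ends m d).1 ∧ (ends m d).1 < (ends m d).2 ∧ (ends m d).2 ≤ m - 1) ∧
      ends m d ∉ chords m S ∧ ∀ f ∈ chords m S, ¬ CrossBefore (ends m d) f ∧
        ¬ CrossBefore f (ends m d)) ↔
      IsDiag m d ∧ d ∉ S ∧ ∀ f ∈ S, ¬ Cross m d f := by
  have : NeZero m := ⟨by omega⟩
  have hlt := ends_snd_lt d
  have hmem : ends m d ∉ chords m S ↔ ends m d ≠ (0, m - 1) ∧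
      ¬ ((ends m d).1 < m - 1 ∧ (ends m d).2 = (ends m d).1 + 1) ∧ d ∉ S := by
    rw [mem_chords]
    simp only [(ends_injective m).eq_iff, exists_eq_right]
    tauto
  rw [hmem, isDiag_iff hm]
  simp only [ne_eq, Prod.ext_iff]
  constructor
  · rintro ⟨h1, ⟨h2, h3, h4⟩, h5⟩
    refine ⟨by omega, h4, fun f hf hcr => ?_⟩
    have := h5 _ (mem_chords.2 (Or.inr (Or.inr ⟨f, hf, rfl⟩)))
    have := (cross_iff d f).1 hcr
    tauto
  · rintro ⟨h1, h2, h3⟩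
    refine ⟨by omega, ⟨by omega, by omega, h2⟩, fun f hf => ?_⟩
    rcases mem_chords.1 hf with rfl | hf' | ⟨f, hfS, rfl⟩
    · simp only [CrossBefore]; omega
    · simp only [CrossBefore]; omega
    · have := h3 f hfS
      rw [cross_iff] at this
      tauto

theorem Cross.symm {m : ℕ} [NeZero m] {e f : Sym2 (ZMod m)} (h : Cross m e f) : Cross m f e := by
  rw [cross_iff] at h ⊢
  exact h.symm

/-- For any non-trivial bicolouring of `P_m` (`m ≥ 4`), every set of
`m - 4` pairwise non-crossing permitted diagonals is contained in at least one and at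
most two permissible triangulations. -/
theorem codim_one_in_one_or_two (m : ℕ) (hm : 4 ≤ m) (c : ZMod m → Bool)
    (hc : IsNontrivialBicolouring m c)
    (S : Finset (Sym2 (ZMod m))) (hScard : S.card = m - 4)
    (hSdiag : ∀ e ∈ S, IsDiag m e ∧ Permitted m c e)
    (hScross : ∀ e ∈ S, ∀ f ∈ S, e ≠ f → ¬ Cross m e f) :
    (∃ T : Finset (Sym2 (ZMod m)), IsPermissible m c T ∧ S ⊆ T) ∧
      ∀ T₁ T₂ T₃ : Finset (Sym2 (ZMod m)),
        IsPermissible m c T₁ → S ⊆ T₁ →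
        IsPermissible m c T₂ → S ⊆ T₂ →
        IsPermissible m c T₃ → S ⊆ T₃ →
        T₁ = T₂ ∨ T₁ = T₃ ∨ T₂ = T₃ := by
  have : NeZero m := ⟨by omega⟩
  have hSd : ∀ e ∈ S, IsDiag m e := fun e he => (hSdiag e he).1
  have hdis := isDissection_chords hm hSd hScross
  obtain ⟨p, q, r, s, hpq, hqr, hrs, m1, m2, m3, m4, hiff⟩ :=
    hdis.exists_quadrilateral_iff (by rw [card_chords hm hSd]; omega)
  have hsm := (hdis.mem_bounds _ m4).2.2
  simp only at hsm
  have hadd : ∀ d : Sym2 (ZMod m), (IsDiag m d ∧ d ∉ S ∧ ∀ f ∈ S, ¬ Cross m d f) ↔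
      d = s((p : ZMod m), (r : ZMod m)) ∨ d = s((q : ZMod m), (s : ZMod m)) := by
    intro d
    rw [← addable_iff hm, hiff, ← ends_natCast (m := m) (a := p) (b := r) (by omega) (by omega),
      ← ends_natCast (m := m) (a := q) (b := s) (by omega) (by omega),
      (ends_injective m).eq_iff, (ends_injective m).eq_iff]
  constructor
  · have hperm : Permitted m c s((p : ZMod m), (r : ZMod m)) ∨
        Permitted m c s((q : ZMod m), (s : ZMod m)) := by
      by_contra! hnot
      simp only [Permitted, Sym2.mem_iff, exists_eq_or_imp, exists_eq_left, not_or] at hnot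
      obtain ⟨⟨hp, hr⟩, hq, hs⟩ := hnot
      have side : ∀ a b : ℕ, a < b → b < m → c a ≠ true → c b ≠ true → (a, b) ∈ chords m S →
          (a = 0 ∧ b = m - 1) ∨ b = a + 1 := by
        intro a b hab hbm ha hb hmem
        rcases mem_chords.1 hmem with h | h | ⟨f, hf, h⟩
        · exact Or.inl (Prod.mk.inj h)
        · exact Or.inr h.2
        · rw [← ends_natCast hab hbm, (ends_injective m).eq_iff] at h
          obtain ⟨v, hv, hcv⟩ := (hSdiag f hf).2
          rw [h, Sym2.mem_iff] at hv
          rcases hv with rfl | rfl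
          · exact absurd hcv ha
          · exact absurd hcv hb
      have e1 := side p q hpq (by omega) hp hq m1
      have e2 := side q r hqr (by omega) hq hr m2
      have e3 := side r s hrs (by omega) hr hs m3
      have e4 := side p s (by omega) (by omega) hp hs m4
      obtain ⟨v, hv⟩ := hc.1.1
      have hvm := v.val_lt
      have hcases : v.val = p ∨ v.val = q ∨ v.val = r ∨ v.val = s := by omega
      rw [← ZMod.natCast_zmod_val v] at hv
      rcases hcases with h | h | h | h <;> rw [h] at hv <;> contradiction
    have hext : ∀ d : Sym2 (ZMod m), (IsDiag m d ∧ d ∉ S ∧ ∀ f ∈ S, ¬ Cross m d f) →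
        Permitted m c d → ∃ T : Finset (Sym2 (ZMod m)), IsPermissible m c T ∧ S ⊆ T := by
      rintro d ⟨hd, hdS, hdcr⟩ hdp
      refine ⟨insert d S, ⟨⟨?_, ?_, ?_⟩, ?_⟩, Finset.subset_insert d S⟩
      · rw [Finset.card_insert_of_notMem hdS]
        omega
      · exact Finset.forall_mem_insert _ _ _ |>.2 ⟨hd, hSd⟩
      · intro e he f hf hne
        obtain he' | he' := Finset.mem_insert.1 he <;> obtain hf' | hf' := Finset.mem_insert.1 hf
        · exact absurd (he'.trans hf'.symm) hne
        · exact he' ▸ hdcr f hf'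
        · exact hf' ▸ fun h => hdcr e he' h.symm
        · exact hScross e he' f hf' hne
      · exact Finset.forall_mem_insert _ _ _ |>.2 ⟨hdp, fun e he => (hSdiag e he).2⟩
    rcases hperm with h | h
    · exact hext _ ((hadd _).2 (Or.inl rfl)) h
    · exact hext _ ((hadd _).2 (Or.inr rfl)) h
  · have hins : ∀ T : Finset (Sym2 (ZMod m)), IsPermissible m c T → S ⊆ T →
        T = insert s((p : ZMod m), (r : ZMod m)) S ∨
          T = insert s((q : ZMod m), (s : ZMod m)) S := by
      rintro T ⟨⟨hTcard, hTd, hTcr⟩, -⟩ hST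
      have hsdiff := Finset.card_sdiff_add_card_eq_card hST
      obtain ⟨d, hd⟩ := Finset.card_eq_one.1 (show (T \ S).card = 1 by omega)
      have hT : T = insert d S := by
        rw [← Finset.sdiff_union_of_subset hST, hd, Finset.insert_eq]
      have hdT : d ∈ T \ S := by simp [hd]
      rw [Finset.mem_sdiff] at hdT
      have := (hadd d).1 ⟨hTd d hdT.1, hdT.2, fun f hf =>
        hTcr d hdT.1 f (hST hf) fun h => hdT.2 (h ▸ hf)⟩
      rcases this with rfl | rfl
      · exact Or.inl hT
      · exact Or.inr hT
    intro T₁ T₂ T₃ h1 hS1 h2 hS2 h3 hS3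
    rcases hins T₁ h1 hS1 with rfl | rfl <;> rcases hins T₂ h2 hS2 with rfl | rfl <;>
      rcases hins T₃ h3 hS3 with rfl | rfl <;> simp

end Poly
end

section
/- For any non-trivial bicolouring of the convex m-gon P_m (m ≥ 4), the complex of permitted diagonals is an (m−4)-pseudo-manifold with boundary; concretely: (i) every set of pairwise non-crossing permitted diagonals is contained in a set of m−3 pairwise non-crossing permitted diagonals; (ii) any two permissible triangulations are joined by a sequence of permissible triangulations in which consecutive ones share exactly m−4 diagonals; (iii) every set of m−4 pairwise non-crossing permitted diagonals is contained in at most two permissible triangulations. -/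
/-!
Vertices of the convex `m`-gon `P_m` are identified with `ZMod m` in cyclic order.
Blue is encoded by the Boolean value `true`, red by `false`.
-/

namespace Poly

/-- The pair `p` is a chord of the polygon with vertices `0, …, m - 1` that is not a side. -/
def NatDiag (m : ℕ) (p : ℕ × ℕ) : Prop :=
  p.1 + 2 ≤ p.2 ∧ p.2 < m ∧ ¬ (p.1 = 0 ∧ p.2 + 1 = m)

/-- Crossing of chords `p`, `q` that are written with increasing endpoints. -/
def NatCross (p q : ℕ × ℕ) : Prop :=
  (p.1 < q.1 ∧ q.1 < p.2 ∧ p.2 < q.2) ∨ (q.1 < p.1 ∧ p.1 < q.2 ∧ q.2 < p.2)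

/-- A set of pairwise non-crossing diagonals. -/
def NatNonCrossing (m : ℕ) (T : Finset (ℕ × ℕ)) : Prop :=
  (∀ p ∈ T, NatDiag m p) ∧ ∀ p ∈ T, ∀ q ∈ T, ¬ NatCross p q

/-- A chord with a blue endpoint. -/
def NatPermitted (c : ℕ → Bool) (p : ℕ × ℕ) : Prop :=
  c p.1 = true ∨ c p.2 = true

/-- A triangulation all of whose diagonals have a blue endpoint. -/
def NatPermissible (m : ℕ) (c : ℕ → Bool) (T : Finset (ℕ × ℕ)) : Prop :=
  T.card = m - 3 ∧ NatNonCrossing m T ∧ ∀ p ∈ T, NatPermitted c p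

/-- Every permitted diagonal compatible with `T` lies in `T`. -/
def NatSaturated (m : ℕ) (c : ℕ → Bool) (T : Finset (ℕ × ℕ)) : Prop :=
  ∀ p, NatDiag m p → NatPermitted c p → (∀ q ∈ T, ¬ NatCross p q) → p ∈ T

/-- The vertex `k` is the apex of the triangle lying below the chord `p`, all of whose other
sides are sides of the polygon or members of `T`. -/
def IsApex (T : Finset (ℕ × ℕ)) (k : ℕ) (p : ℕ × ℕ) : Prop :=
  p.1 < k ∧ k < p.2 ∧ (k = p.1 + 1 ∨ (p.1, k) ∈ T) ∧ (p.2 = k + 1 ∨ (k, p.2) ∈ T)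

lemma NatCross.symm {p q : ℕ × ℕ} (h : NatCross p q) : NatCross q p := Or.symm h

lemma not_natCross_self (p : ℕ × ℕ) : ¬ NatCross p p := by
  unfold NatCross; omega

lemma NatNonCrossing.insert_of_compatible {m : ℕ} {T : Finset (ℕ × ℕ)} (hT : NatNonCrossing m T)
    {p : ℕ × ℕ} (hp : NatDiag m p) (h : ∀ q ∈ T, ¬ NatCross p q) :
    NatNonCrossing m (insert p T) := by
  refine ⟨fun q hq => ?_, fun q hq r hr => ?_⟩
  · rcases Finset.mem_insert.1 hq with rfl | hq
    exacts [hp, hT.1 q hq]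
  · rw [Finset.mem_insert] at hq hr
    rcases hq with rfl | hq <;> rcases hr with rfl | hr
    exacts [not_natCross_self _, h r hr, fun hc => h q hq hc.symm, hT.2 q hq r hr]

lemma NatNonCrossing.mono {m : ℕ} {S T : Finset (ℕ × ℕ)} (hT : NatNonCrossing m T)
    (h : S ⊆ T) : NatNonCrossing m S :=
  ⟨fun p hp => hT.1 p (h hp), fun p hp q hq => hT.2 p (h hp) q (h hq)⟩

/-- The long side `{0, m - 1}` crosses nothing and is not a diagonal. -/
lemma card_insert_long_side {m : ℕ} (hm : 4 ≤ m) {T : Finset (ℕ × ℕ)}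
    (hT : NatNonCrossing m T) : (insert (0, m - 1) T).card = T.card + 1 := by
  refine Finset.card_insert_of_notMem fun h => ?_
  exact (hT.1 _ h).2.2 ⟨rfl, by simp only; omega⟩

lemma NatNonCrossing.card_le {m : ℕ} (hm : 4 ≤ m) {T : Finset (ℕ × ℕ)}
    (hT : NatNonCrossing m T) : T.card ≤ m - 3 := by
  have key : (insert (0, m - 1) T).card ≤ (Finset.Ioo 0 (m - 1)).card := by
    refine Finset.card_le_card_of_forall_subsingleton
      (fun p k => p.1 < k ∧ k < p.2 ∧ (k = p.1 + 1 ∨ (p.1, k) ∈ T) ∧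
        ∀ j, j < p.2 → (p.1, j) ∈ T → j ≤ k) ?_ ?_
    · rintro ⟨a, b⟩ hp
      have hab : a + 2 ≤ b ∧ b < m := by
        rcases Finset.mem_insert.1 hp with h | h
        · simp only [Prod.mk.injEq] at h; omega
        · have := hT.1 _ h; simp only [NatDiag] at this; omega
      obtain ⟨k, hk, hmax⟩ := Finset.exists_max_image
        ((Finset.Ioo a b).filter fun k => k = a + 1 ∨ (a, k) ∈ T) id
        ⟨a + 1, by simp; omega⟩
      simp only [Finset.mem_filter, Finset.mem_Ioo, id] at hk hmax
      refine ⟨k, by simp only [Finset.mem_Ioo]; omega, hk.1.1, hk.1.2, hk.2, fun j hj hjT => ?_⟩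
      have := hT.1 _ hjT
      simp only [NatDiag] at this
      exact hmax j ⟨⟨by omega, hj⟩, Or.inr hjT⟩
    · intro k hk
      rintro ⟨a, b⟩ ⟨hp, h1, h2, h3, h4⟩ ⟨a', b'⟩ ⟨hp', h1', h2', h3', h4'⟩
      simp only [Finset.mem_Ioo] at *
      have aux : ∀ a b a' b' : ℕ, (a', b') ∈ insert (0, m - 1) T → a < k → k < b →
          (k = a + 1 ∨ (a, k) ∈ T) → a' < k → k < b' → a' ≤ a := by
        intro a b a' b' hp' h1 h2 h3 h1' h2'
        by_contra! hlt
        have hak : (a, k) ∈ T := by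
          rcases h3 with h | h
          · omega
          · exact h
        rcases Finset.mem_insert.1 hp' with h | h
        · simp only [Prod.mk.injEq] at h; omega
        · exact hT.2 _ hak _ h (Or.inl ⟨hlt, h1', h2'⟩)
      obtain rfl : a = a' := le_antisymm (aux a' b' a b hp h1' h2' h3' h1 h2)
        (aux a b a' b' hp' h1 h2 h3 h1' h2')
      have aux2 : ∀ b b' : ℕ, (a, b) ∈ insert (0, m - 1) T → (a, b') ∈ insert (0, m - 1) T →
          k < b → (∀ j, j < b' → (a, j) ∈ T → j ≤ k) → b' ≤ b := by
        intro b b' hp hp' h2 h4'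
        by_contra! hlt
        rcases Finset.mem_insert.1 hp with h | h
        · rcases Finset.mem_insert.1 hp' with h' | h'
          · simp only [Prod.mk.injEq] at h h'; omega
          · have := hT.1 _ h'
            simp only [Prod.mk.injEq, NatDiag] at h this; omega
        · have := h4' b hlt h; omega
      rw [le_antisymm (aux2 b' b hp' hp h2' h4) (aux2 b b' hp hp' h2 h4')]
  rw [card_insert_long_side hm hT, Nat.card_Ioo] at key
  omega

lemma NatPermissible.saturated {m : ℕ} (hm : 4 ≤ m) {c : ℕ → Bool} {T : Finset (ℕ × ℕ)}
    (hT : NatPermissible m c T) : NatSaturated m c T := by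
  intro p hp _ h
  by_contra hpT
  have := (hT.2.1.insert_of_compatible hp h).card_le hm
  rw [Finset.card_insert_of_notMem hpT, hT.1] at this
  omega

lemma exists_isApex {m : ℕ} (hm : 4 ≤ m) {c : ℕ → Bool} (hc : c 0 = true)
    {T : Finset (ℕ × ℕ)} (hT : NatNonCrossing m T) (hperm : ∀ p ∈ T, NatPermitted c p)
    (hsat : NatSaturated m c T) {k : ℕ} (hk : k ∈ Finset.Ioo 0 (m - 1)) :
    ∃ p, p ∈ insert (0, m - 1) T ∧ IsApex T k p := by
  rw [Finset.mem_Ioo] at hk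
  obtain ⟨⟨a, b⟩, hp, hmin⟩ := Finset.exists_min_image
    ((insert (0, m - 1) T).filter fun p => p.1 < k ∧ k < p.2) (fun p => p.2 - p.1)
    ⟨(0, m - 1), by simp; omega⟩
  simp only [Finset.mem_filter] at hp hmin
  obtain ⟨hp, hak, hkb⟩ := hp
  have hbm : b < m ∧ (c a = true ∨ c b = true) := by
    rcases Finset.mem_insert.1 hp with h | h
    · simp only [Prod.mk.injEq] at h
      exact ⟨by omega, Or.inl (h.1 ▸ hc)⟩
    · exact ⟨(hT.1 _ h).2.1, hperm _ h⟩
  have hcross : ∀ x y, (x, y) ∈ T → ¬ NatCross (a, b) (x, y) := by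
    intro x y hxy
    rcases Finset.mem_insert.1 hp with h | h
    · have := hT.1 _ hxy
      simp only [Prod.mk.injEq, NatCross, NatDiag] at *; omega
    · exact hT.2 _ h _ hxy
  have hcov : ∀ x y, (x, y) ∈ T → x < k → k < y → x ≤ a ∧ b ≤ y := by
    intro x y hxy hx hy
    have h1 := hmin (x, y) ⟨Finset.mem_insert_of_mem hxy, hx, hy⟩
    have h2 := hcross x y hxy
    simp only [NatCross] at h1 h2
    omega
  have hleft : ∀ q ∈ T, ¬ NatCross (a, k) q := by
    rintro ⟨x, y⟩ hq hx
    have h1 := hcov x y hq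
    have h2 := hcross x y hq
    simp only [NatCross] at hx h2
    omega
  have hright : ∀ q ∈ T, ¬ NatCross (k, b) q := by
    rintro ⟨x, y⟩ hq hx
    have h1 := hcov x y hq
    have h2 := hcross x y hq
    simp only [NatCross] at hx h2
    omega
  have hleft' : (c a = true ∨ c k = true) → k = a + 1 ∨ (a, k) ∈ T := by
    intro h
    by_cases hka : k = a + 1
    · exact Or.inl hka
    · exact Or.inr (hsat _ (by simp only [NatDiag]; omega) h hleft)
  have hright' : (c k = true ∨ c b = true) → b = k + 1 ∨ (k, b) ∈ T := by
    intro h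
    by_cases hka : b = k + 1
    · exact Or.inl hka
    · exact Or.inr (hsat _ (by simp only [NatDiag]; omega) h hright)
  refine ⟨(a, b), hp, hak, hkb, ?_, ?_⟩
  · by_cases hca : c a = true
    · exact hleft' (Or.inl hca)
    obtain ⟨x, hx, hmax⟩ := Finset.exists_min_image
      ((Finset.Ico a k).filter fun x => k = x + 1 ∨ (x, k) ∈ T) id
      ⟨k - 1, by simp; omega⟩
    simp only [Finset.mem_filter, Finset.mem_Ico, id] at hx hmax
    obtain ⟨⟨hax, hxk⟩, hxT⟩ := hx
    rcases hax.eq_or_lt with rfl | hax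
    · exact hxT
    have hmem : (x, b) ∈ T := by
      refine hsat _ (by simp only [NatDiag]; omega) (Or.inr (hbm.2.resolve_left hca)) ?_
      rintro ⟨y, z⟩ hq hx
      have h1 := hcov y z hq
      have h2 := hcross y z hq
      have h4 : x + 1 < k → ¬ NatCross (x, k) (y, z) := fun h =>
        hT.2 _ (hxT.resolve_left (by omega)) _ hq
      simp only [NatCross] at hx h2 h4
      by_cases hzk : z = k
      · subst hzk
        by_cases hya : a ≤ y
        · have := hmax y ⟨⟨hya, by omega⟩, Or.inr hq⟩
          omega
        · omega
      · omega
    have := hcov x b hmem hxk hkb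
    omega
  · by_cases hcb : c b = true
    · exact hright' (Or.inr hcb)
    obtain ⟨x, hx, hmax⟩ := Finset.exists_max_image
      ((Finset.Ioc k b).filter fun x => x = k + 1 ∨ (k, x) ∈ T) id
      ⟨k + 1, by simp; omega⟩
    simp only [Finset.mem_filter, Finset.mem_Ioc, id] at hx hmax
    obtain ⟨⟨hkx, hxb⟩, hxT⟩ := hx
    rcases hxb.eq_or_lt with rfl | hxb
    · exact hxT
    have hmem : (a, x) ∈ T := by
      refine hsat _ (by simp only [NatDiag]; omega) (Or.inl (hbm.2.resolve_right hcb)) ?_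
      rintro ⟨y, z⟩ hq hx
      have h1 := hcov y z hq
      have h2 := hcross y z hq
      have h4 : k + 1 < x → ¬ NatCross (k, x) (y, z) := fun h =>
        hT.2 _ (hxT.resolve_left (by omega)) _ hq
      simp only [NatCross] at hx h2 h4
      by_cases hyk : y = k
      · subst hyk
        by_cases hzb : z ≤ b
        · have := hmax z ⟨⟨by omega, hzb⟩, Or.inr hq⟩
          omega
        · omega
      · omega
    have := hcov a x hmem hak hkx
    omega

lemma isApex_unique {m : ℕ} {T : Finset (ℕ × ℕ)} (hT : NatNonCrossing m T) {p : ℕ × ℕ}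
    {k l : ℕ} (hk : IsApex T k p) (hl : IsApex T l p) : k = l := by
  have aux : ∀ k l, IsApex T k p → IsApex T l p → l ≤ k := by
    intro k l hk hl
    by_contra! hlt
    obtain ⟨h1, h2, -, h3⟩ := hk
    obtain ⟨h1', h2', h3', -⟩ := hl
    exact hT.2 _ (h3'.resolve_left (by omega)) _ (h3.resolve_left (by omega))
      (Or.inl ⟨h1, hlt, h2'⟩)
  exact le_antisymm (aux l k hl hk) (aux k l hk hl)

lemma card_of_saturated {m : ℕ} (hm : 4 ≤ m) {c : ℕ → Bool} (hc : c 0 = true)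
    {T : Finset (ℕ × ℕ)} (hT : NatNonCrossing m T) (hperm : ∀ p ∈ T, NatPermitted c p)
    (hsat : NatSaturated m c T) : T.card = m - 3 := by
  refine le_antisymm (hT.card_le hm) ?_
  have key := Finset.card_le_card_of_forall_subsingleton (IsApex T)
    (fun k hk => exists_isApex hm hc hT hperm hsat hk)
    (fun p _ k hk l hl => isApex_unique hT hk.2 hl.2)
  rw [card_insert_long_side hm hT, Nat.card_Ioo] at key
  omega

lemma NatPermissible.exists_isApex_of_mem {m : ℕ} (hm : 4 ≤ m) {c : ℕ → Bool}
    (hc : c 0 = true) {T : Finset (ℕ × ℕ)} (hT : NatPermissible m c T) {p : ℕ × ℕ}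
    (hp : p ∈ T) : ∃ k, IsApex T k p := by
  by_contra! hno
  have key := Finset.card_le_card_of_forall_subsingleton (IsApex T)
    (s := Finset.Ioo 0 (m - 1)) (t := (insert (0, m - 1) T).erase p)
    (fun k hk => by
      obtain ⟨q, hq, hkq⟩ := exists_isApex hm hc hT.2.1 hT.2.2 (hT.saturated hm) hk
      exact ⟨q, Finset.mem_erase.2 ⟨fun h => hno k (h ▸ hkq), hq⟩, hkq⟩)
    (fun p _ k hk l hl => isApex_unique hT.2.1 hk.2 hl.2)
  rw [Finset.card_erase_of_mem (Finset.mem_insert_of_mem hp), card_insert_long_side hm hT.2.1,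
    Nat.card_Ioo, hT.1] at key
  omega

lemma exists_natPermissible_superset {m : ℕ} (hm : 4 ≤ m) {c : ℕ → Bool} (hc : c 0 = true)
    {S : Finset (ℕ × ℕ)} (hS : NatNonCrossing m S) (hperm : ∀ p ∈ S, NatPermitted c p) :
    ∃ T, NatPermissible m c T ∧ S ⊆ T := by
  by_cases hsat : NatSaturated m c S
  · exact ⟨S, ⟨card_of_saturated hm hc hS hperm hsat, hS, hperm⟩, subset_rfl⟩
  · simp only [NatSaturated, not_forall] at hsat
    obtain ⟨p, hp, hpc, hpS, hmem⟩ := hsat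
    have hS' := hS.insert_of_compatible hp hpS
    have hcard := hS'.card_le hm
    rw [Finset.card_insert_of_notMem hmem] at hcard
    obtain ⟨T, hT, hST⟩ := exists_natPermissible_superset hm hc hS'
      (Finset.forall_mem_insert _ _ _ |>.2 ⟨hpc, hperm⟩)
    exact ⟨T, hT, (Finset.subset_insert _ _).trans hST⟩
termination_by m - S.card
decreasing_by
  have := Finset.card_insert_of_notMem hmem
  omega

/-- Consecutive permissible triangulations of a flip sequence. -/
def NatFlip (m : ℕ) (c : ℕ → Bool) (T U : Finset (ℕ × ℕ)) : Prop :=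
  NatPermissible m c T ∧ NatPermissible m c U ∧ (T ∩ U).card = m - 4

/-- The fan of diagonals at the vertex `0`. -/
def fan (m : ℕ) : Finset (ℕ × ℕ) := (Finset.Ico 2 (m - 1)).image fun j => (0, j)

lemma card_fan (m : ℕ) : (fan m).card = m - 3 := by
  rw [fan, Finset.card_image_of_injective _ (Prod.mk_right_injective 0), Nat.card_Ico]
  omega

/-- A permissible triangulation other than the fan at the blue vertex `0` has a flip increasing
the degree of `0`. -/
lemma NatPermissible.exists_flip {m : ℕ} (hm : 4 ≤ m) {c : ℕ → Bool} (hc : c 0 = true)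
    {T : Finset (ℕ × ℕ)} (hT : NatPermissible m c T) (hne : ¬ fan m ⊆ T) :
    ∃ U, NatFlip m c T U ∧ (fan m ∩ T).card < (fan m ∩ U).card := by
  obtain ⟨q, hq, hqT⟩ := Finset.not_subset.1 hne
  obtain ⟨j, hj, rfl⟩ := Finset.mem_image.1 hq
  rw [Finset.mem_Ico] at hj
  have hex : ∃ q ∈ T, NatCross (0, j) q := by
    by_contra! h
    exact hqT (hT.saturated hm _ (by simp only [NatDiag]; omega) (Or.inl hc) h)
  obtain ⟨⟨a, b⟩, hab, hmax⟩ := Finset.exists_max_image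
    (T.filter fun p => 0 < p.1 ∧ p.1 < j ∧ j < p.2) (fun p => p.2 - p.1) (by
      obtain ⟨⟨x, y⟩, hx, hxy⟩ := hex
      refine ⟨(x, y), Finset.mem_filter.2 ⟨hx, ?_⟩⟩
      simp only [NatCross] at hxy ⊢
      omega)
  simp only [Finset.mem_filter] at hab hmax
  obtain ⟨hab, ha, haj, hjb⟩ := hab
  obtain ⟨k, hak, hkb, hk1, hk2⟩ := hT.exists_isApex_of_mem hm hc hab
  simp only at hak hkb hk1 hk2
  have hbm := hT.2.1.1 _ hab
  simp only [NatDiag] at hbm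
  have hkT : (0, k) ∉ T := fun h => hT.2.1.2 _ h _ hab (Or.inl ⟨ha, hak, hkb⟩)
  have hcompat : ∀ q ∈ T.erase (a, b), ¬ NatCross (0, k) q := by
    rintro ⟨x, y⟩ hq hx
    obtain ⟨hne, hq⟩ := Finset.mem_erase.1 hq
    have h1 := hT.2.1.2 _ hab _ hq
    have h2 := fun h => hmax (x, y) ⟨hq, h⟩
    have h3 : k ≠ a + 1 → ¬ NatCross (a, k) (x, y) := fun h =>
      hT.2.1.2 _ (hk1.resolve_left h) _ hq
    have h4 : b ≠ k + 1 → ¬ NatCross (k, b) (x, y) := fun h =>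
      hT.2.1.2 _ (hk2.resolve_left h) _ hq
    simp only [NatCross, Prod.mk.injEq, ne_eq] at *
    omega
  have hkfan : (0, k) ∈ fan m :=
    Finset.mem_image.2 ⟨k, Finset.mem_Ico.2 (by omega), rfl⟩
  have hk' : (0, k) ∉ T.erase (a, b) := fun h => hkT (Finset.mem_of_mem_erase h)
  have hcard := Finset.card_erase_of_mem hab
  rw [hT.1] at hcard
  refine ⟨insert (0, k) (T.erase (a, b)), ⟨hT, ⟨?_, ?_, ?_⟩, ?_⟩, ?_⟩
  · rw [Finset.card_insert_of_notMem hk', hcard]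
    omega
  · exact (hT.2.1.mono (Finset.erase_subset _ _)).insert_of_compatible
      (by simp only [NatDiag]; omega) hcompat
  · exact (Finset.forall_mem_insert _ _ _).2
      ⟨Or.inl hc, fun p hp => hT.2.2 p (Finset.mem_of_mem_erase hp)⟩
  · rw [Finset.inter_insert_of_notMem hkT,
      Finset.inter_eq_right.2 (Finset.erase_subset _ _), hcard]
    omega
  · refine Finset.card_lt_card (Finset.ssubset_iff_of_subset ?_ |>.2 ⟨(0, k), ?_, ?_⟩)
    · intro p hp
      obtain ⟨hpf, hpT⟩ := Finset.mem_inter.1 hp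
      refine Finset.mem_inter.2 ⟨hpf, Finset.mem_insert_of_mem (Finset.mem_erase.2 ⟨?_, hpT⟩)⟩
      rintro rfl
      obtain ⟨i, -, hi⟩ := Finset.mem_image.1 hpf
      simp only [Prod.mk.injEq] at hi
      omega
    · exact Finset.mem_inter.2 ⟨hkfan, Finset.mem_insert_self _ _⟩
    · exact fun h => hkT (Finset.mem_inter.1 h).2

lemma NatPermissible.reflTransGen_fan {m : ℕ} (hm : 4 ≤ m) {c : ℕ → Bool} (hc : c 0 = true)
    {T : Finset (ℕ × ℕ)} (hT : NatPermissible m c T) :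
    Relation.ReflTransGen (NatFlip m c) T (fan m) := by
  by_cases h : fan m ⊆ T
  · rw [Finset.eq_of_subset_of_card_le h (by rw [hT.1, card_fan])]
  · obtain ⟨U, hTU, hlt⟩ := hT.exists_flip hm hc h
    exact .head hTU (hTU.2.1.reflTransGen_fan hm hc)
termination_by m - (fan m ∩ T).card
decreasing_by
  have := Finset.card_le_card (Finset.inter_subset_left (s₁ := fan m) (s₂ := U))
  rw [card_fan] at this
  omega

lemma NatFlip.symm {m : ℕ} {c : ℕ → Bool} {T U : Finset (ℕ × ℕ)} (h : NatFlip m c T U) :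
    NatFlip m c U T :=
  ⟨h.2.1, h.1, Finset.inter_comm T U ▸ h.2.2⟩

lemma NatPermissible.reflTransGen {m : ℕ} (hm : 4 ≤ m) {c : ℕ → Bool} (hc : c 0 = true)
    {T U : Finset (ℕ × ℕ)} (hT : NatPermissible m c T) (hU : NatPermissible m c U) :
    Relation.ReflTransGen (NatFlip m c) T U :=
  (hT.reflTransGen_fan hm hc).trans
    (Relation.ReflTransGen.mono (fun _ _ h => NatFlip.symm h) _ _
      (Relation.reflTransGen_swap.2 (hU.reflTransGen_fan hm hc)))

/-- Among three diagonals compatible with `m - 4` pairwise non-crossing diagonals, two do not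
cross. -/
lemma not_three_cross {m : ℕ} (hm : 4 ≤ m) {S : Finset (ℕ × ℕ)} (hcard : S.card = m - 4)
    {e f g : ℕ × ℕ} (he : NatNonCrossing m (insert e S)) (hf : NatNonCrossing m (insert f S))
    (hg : NatNonCrossing m (insert g S)) (hef : NatCross e f) (heg : NatCross e g)
    (hfg : NatCross f g) : False := by
  wlog hlt : e.1 < f.1 generalizing e f
  · refine this hf he hef.symm hfg heg ?_
    simp only [NatCross] at hef
    omega
  have mem_self : ∀ p : ℕ × ℕ, p ∈ insert p S := fun p => Finset.mem_insert_self _ _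
  have key : ∀ s : ℕ × ℕ, s.1 < s.2 → s.2 < m → ¬ NatCross s e → NatCross s g → s ≠ e →
      (∀ q, ¬ NatCross e q → ¬ NatCross f q → ¬ NatCross s q) → False := by
    intro s hs hsm hse hsg hne hq
    have hsS : s ∉ S := fun h =>
      hg.2 s (Finset.mem_insert_of_mem h) g (mem_self g) hsg
    have hgd := hg.1 g (mem_self g)
    have h1 : NatNonCrossing m (insert s (insert e S)) := by
      refine he.insert_of_compatible ?_ ((Finset.forall_mem_insert _ _ _).2 ⟨hse, fun q hqS => hq q
        (he.2 e (mem_self e) q (Finset.mem_insert_of_mem hqS))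
        (hf.2 f (mem_self f) q (Finset.mem_insert_of_mem hqS))⟩)
      simp only [NatCross, NatDiag] at *
      omega
    have heS : e ∉ S := fun h =>
      hf.2 e (Finset.mem_insert_of_mem h) f (mem_self f) hef
    have := h1.card_le hm
    rw [Finset.card_insert_of_notMem (by simp [hne, hsS]), Finset.card_insert_of_notMem heS,
      hcard] at this
    omega
  obtain ⟨a, b⟩ := e
  obtain ⟨a', b'⟩ := f
  obtain ⟨x, y⟩ := g
  have hbm := (he.1 _ (mem_self _)).2.1
  simp only [NatCross] at hef heg hfg hlt hbm
  by_cases h : a < x ∧ x < a'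
  · refine key (a, a') ?_ ?_ ?_ ?_ ?_ ?_
    all_goals simp only [NatCross, ne_eq, Prod.mk.injEq, Prod.forall]
    all_goals omega
  · refine key (a', b) ?_ ?_ ?_ ?_ ?_ ?_
    all_goals simp only [NatCross, ne_eq, Prod.mk.injEq, Prod.forall]
    all_goals omega

lemma natPermissible_eq_or_eq_or_eq {m : ℕ} (hm : 4 ≤ m) {c : ℕ → Bool} {S : Finset (ℕ × ℕ)}
    (hcard : S.card = m - 4) {T₁ T₂ T₃ : Finset (ℕ × ℕ)} (h₁ : NatPermissible m c T₁)
    (hS₁ : S ⊆ T₁) (h₂ : NatPermissible m c T₂) (hS₂ : S ⊆ T₂) (h₃ : NatPermissible m c T₃)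
    (hS₃ : S ⊆ T₃) : T₁ = T₂ ∨ T₁ = T₃ ∨ T₂ = T₃ := by
  have hins : ∀ T, NatPermissible m c T → S ⊆ T → ∃ e, e ∉ S ∧ insert e S = T := by
    intro T hT hST
    have h : (T \ S).card = 1 := by
      rw [Finset.card_sdiff_of_subset hST, hT.1, hcard]
      omega
    obtain ⟨e, he⟩ := Finset.card_eq_one.1 h
    have heT : e ∈ T \ S := he ▸ Finset.mem_singleton_self e
    refine ⟨e, (Finset.mem_sdiff.1 heT).2, ?_⟩
    rw [← Finset.sdiff_union_of_subset hST, he, Finset.insert_eq]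
  obtain ⟨e, heS, rfl⟩ := hins _ h₁ hS₁
  obtain ⟨f, hfS, rfl⟩ := hins _ h₂ hS₂
  obtain ⟨g, hgS, rfl⟩ := hins _ h₃ hS₃
  have hcross : ∀ p q, p ∉ S → q ∉ S → NatPermissible m c (insert p S) →
      NatPermissible m c (insert q S) → p ≠ q → NatCross p q := by
    intro p q hp hq hpS hqS hne
    by_contra hpq
    have h := (hqS.2.1.insert_of_compatible (hpS.2.1.1 p (Finset.mem_insert_self _ _))
      ((Finset.forall_mem_insert _ _ _).2 ⟨hpq, fun r hr => hpS.2.1.2 p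
        (Finset.mem_insert_self _ _) r (Finset.mem_insert_of_mem hr)⟩)).card_le hm
    rw [Finset.card_insert_of_notMem (by simp [hne, hp]), hqS.1] at h
    omega
  by_contra! hne
  exact not_three_cross hm hcard h₁.2.1 h₂.2.1 h₃.2.1
    (hcross e f heS hfS h₁ h₂ fun h => hne.1 (h ▸ rfl))
    (hcross e g heS hgS h₁ h₃ fun h => hne.2.1 (h ▸ rfl))
    (hcross f g hfS hgS h₂ h₃ fun h => hne.2.2 (h ▸ rfl))

/-- The chord of the polygon `ZMod m` with endpoints `v + p.1` and `v + p.2`. -/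
def chord (m : ℕ) (v : ZMod m) (p : ℕ × ℕ) : Sym2 (ZMod m) := s(v + p.1, v + p.2)

lemma natCast_inj_of_lt {m i j : ℕ} (hi : i < m) (hj : j < m) :
    (i : ZMod m) = j ↔ i = j := by
  rw [ZMod.natCast_eq_natCast_iff', Nat.mod_eq_of_lt hi, Nat.mod_eq_of_lt hj]

lemma exists_eq_add_natCast {m : ℕ} [NeZero m] (v x : ZMod m) :
    ∃ i : ℕ, i < m ∧ x = v + i :=
  ⟨(x - v).val, ZMod.val_lt _, by simp⟩

lemma val_add_natCast_sub {m : ℕ} (v : ZMod m) {i j : ℕ} (hi : i < m) (hj : j < m) :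
    ((v + j) - (v + i)).val = if i ≤ j then j - i else m + j - i := by
  rw [add_sub_add_left_eq_sub]
  split_ifs with h
  · rw [← Nat.cast_sub h, ZMod.val_natCast_of_lt (by omega)]
  · rw [show (j : ZMod m) - i = ((m + j - i : ℕ) : ZMod m) by
      rw [Nat.cast_sub (by omega)]; simp, ZMod.val_natCast_of_lt (by omega)]

lemma isDiag_mk_iff {m : ℕ} (x y : ZMod m) :
    IsDiag m s(x, y) ↔ y - x ≠ 0 ∧ y - x ≠ 1 ∧ y - x ≠ -1 := by
  constructor
  · rintro ⟨i, j, h, h0, h1, h2⟩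
    rcases Sym2.eq_iff.1 h with ⟨rfl, rfl⟩ | ⟨rfl, rfl⟩
    · exact ⟨h0, h1, h2⟩
    · rw [← neg_sub]
      exact ⟨neg_ne_zero.2 h0, fun h => h2 (neg_eq_iff_eq_neg.1 h), fun h => h1 (neg_inj.1 h)⟩
  · exact fun h => ⟨x, y, rfl, h⟩

lemma isDiag_chord_iff {m : ℕ} (hm : 4 ≤ m) (v : ZMod m) {p : ℕ × ℕ} (hp : p.1 < p.2)
    (hpm : p.2 < m) : IsDiag m (chord m v p) ↔ NatDiag m p := by
  obtain ⟨a, b⟩ := p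
  simp only at hp hpm
  have h0 : ((b : ZMod m) - a = 0) ↔ b = a := by
    rw [sub_eq_zero, natCast_inj_of_lt (by omega) (by omega)]
  have h1 : ((b : ZMod m) - a = 1) ↔ b = a + 1 := by
    rw [sub_eq_iff_eq_add', ← natCast_inj_of_lt hpm (show a + 1 < m by omega)]
    simp
  have h2 : ((b : ZMod m) - a = -1) ↔ a = 0 ∧ b + 1 = m := by
    rw [sub_eq_iff_eq_add, eq_neg_add_iff_add_eq, add_comm]
    rcases Nat.lt_or_ge (b + 1) m with h | h
    · have := natCast_inj_of_lt h (show a < m by omega)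
      push_cast at this
      rw [this]
      omega
    · obtain rfl : m = b + 1 := by omega
      have := natCast_inj_of_lt (show 0 < b + 1 by omega) (show a < b + 1 by omega)
      have hz := ZMod.natCast_self (b + 1)
      push_cast at this hz
      rw [hz, this]
      omega
  rw [chord, isDiag_mk_iff, add_sub_add_left_eq_sub, ne_eq, ne_eq, ne_eq, h0, h1, h2, NatDiag]
  omega

lemma cross_chord_iff {m : ℕ} [NeZero m] (v : ZMod m) {p q : ℕ × ℕ} (hp : p.1 < p.2)
    (hpm : p.2 < m) (hq : q.1 < q.2) (hqm : q.2 < m) :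
    Cross m (chord m v p) (chord m v q) ↔ NatCross p q := by
  obtain ⟨a, b⟩ := p
  obtain ⟨c, d⟩ := q
  simp only at hp hpm hq hqm
  have inj : ∀ i j : ℕ, i < m → j < m → (v + (i : ZMod m) = v + j ↔ i = j) :=
    fun i j hi hj => by rw [add_right_inj, natCast_inj_of_lt hi hj]
  have hval := fun i j hi hj => val_add_natCast_sub (m := m) v (i := i) (j := j) hi hj
  constructor
  · rintro ⟨x, y, z, w, h1, h2, hxy, hxz, hxw, hyz, hyw, hzw, hx⟩
    obtain ⟨x, hxm, rfl⟩ := exists_eq_add_natCast v x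
    obtain ⟨y, hym, rfl⟩ := exists_eq_add_natCast v y
    obtain ⟨z, hzm, rfl⟩ := exists_eq_add_natCast v z
    obtain ⟨w, hwm, rfl⟩ := exists_eq_add_natCast v w
    have ham : a < m := by omega
    have hcm : c < m := by omega
    simp only [chord, Sym2.eq_iff, inj _ _ ham hxm, inj _ _ ham hym, inj _ _ hpm hxm,
      inj _ _ hpm hym, inj _ _ hcm hzm, inj _ _ hcm hwm, inj _ _ hqm hzm, inj _ _ hqm hwm]
      at h1 h2
    rw [ne_eq, inj _ _ ‹_› ‹_›] at hxy hxz hxw hyz hyw hzw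
    change (_ ∧ ¬ _) ∨ (_ ∧ ¬ _) at hx
    simp only [StrictBtw, hval _ _ hxm hzm, hval _ _ hxm hym, hval _ _ hxm hwm] at hx
    simp only [NatCross]
    rcases h1 with ⟨rfl, rfl⟩ | ⟨rfl, rfl⟩ <;> rcases h2 with ⟨rfl, rfl⟩ | ⟨rfl, rfl⟩ <;>
      split_ifs at hx <;> omega
  · intro h
    simp only [NatCross] at h
    have ham : a < m := by omega
    have hcm : c < m := by omega
    refine ⟨_, _, _, _, rfl, rfl, ?_⟩
    change _ ∧ _ ∧ _ ∧ _ ∧ _ ∧ _ ∧ ((_ ∧ ¬ _) ∨ (_ ∧ ¬ _))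
    simp only [ne_eq, inj _ _ ham hpm, inj _ _ ham hcm, inj _ _ ham hqm, inj _ _ hpm hcm,
      inj _ _ hpm hqm, inj _ _ hcm hqm, StrictBtw, hval _ _ ham hcm, hval _ _ ham hpm,
      hval _ _ ham hqm]
    split_ifs <;> omega

lemma chord_injOn {m : ℕ} (v : ZMod m) : Set.InjOn (chord m v) {p | p.1 < p.2 ∧ p.2 < m} := by
  rintro ⟨a, b⟩ ⟨hab, hb⟩ ⟨c, d⟩ ⟨hcd, hd⟩ h
  simp only at hab hb hcd hd
  simp only [chord, Sym2.eq_iff, add_right_inj, natCast_inj_of_lt (hab.trans hb) (hcd.trans hd),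
    natCast_inj_of_lt (hab.trans hb) hd, natCast_inj_of_lt hb hd,
    natCast_inj_of_lt hb (hcd.trans hd)] at h
  rw [Prod.mk.injEq]
  omega

lemma IsDiag.exists_chord {m : ℕ} (hm : 4 ≤ m) (v : ZMod m) {e : Sym2 (ZMod m)}
    (he : IsDiag m e) : ∃ p, NatDiag m p ∧ chord m v p = e := by
  have : NeZero m := ⟨by omega⟩
  obtain ⟨x, y, rfl, hne, -⟩ := id he
  obtain ⟨i, hi, rfl⟩ := exists_eq_add_natCast v x
  obtain ⟨j, hj, rfl⟩ := exists_eq_add_natCast v y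
  rcases lt_trichotomy i j with h | rfl | h
  · exact ⟨(i, j), (isDiag_chord_iff hm v h hj).1 he, rfl⟩
  · exact absurd (sub_self _) hne
  · have hs : chord m v (j, i) = s(v + (i : ZMod m), v + (j : ZMod m)) := Sym2.eq_swap
    exact ⟨(j, i), (isDiag_chord_iff hm v h hi).1 (hs ▸ he), hs⟩

lemma exists_image_chord_eq {m : ℕ} (hm : 4 ≤ m) (v : ZMod m) {S : Finset (Sym2 (ZMod m))}
    (hS : ∀ e ∈ S, IsDiag m e) :
    ∃ T : Finset (ℕ × ℕ), (∀ p ∈ T, NatDiag m p) ∧ T.image (chord m v) = S := by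
  obtain ⟨T, hT, rfl⟩ := (Finset.subset_set_image_iff (s := {p | NatDiag m p})).1
    (fun e he => IsDiag.exists_chord hm v (hS e he))
  exact ⟨T, fun p hp => hT hp, rfl⟩

lemma NatDiag.mem {m : ℕ} {p : ℕ × ℕ} (hp : NatDiag m p) :
    p ∈ {p : ℕ × ℕ | p.1 < p.2 ∧ p.2 < m} :=
  ⟨lt_of_lt_of_le (by omega) hp.1, hp.2.1⟩

lemma permitted_chord_iff {m : ℕ} (c : ZMod m → Bool) (v : ZMod m) (p : ℕ × ℕ) :
    Permitted m c (chord m v p) ↔ NatPermitted (fun i => c (v + i)) p := by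
  simp [Permitted, chord, NatPermitted]

lemma card_image_chord {m : ℕ} (v : ZMod m) {T : Finset (ℕ × ℕ)}
    (hT : ∀ p ∈ T, NatDiag m p) : (T.image (chord m v)).card = T.card :=
  Finset.card_image_of_injOn fun p hp q hq h => chord_injOn v (hT p hp).mem (hT q hq).mem h

lemma natNonCrossing_of_image_chord {m : ℕ} (hm : 4 ≤ m) (v : ZMod m) {T : Finset (ℕ × ℕ)}
    (hT : ∀ p ∈ T, NatDiag m p) (h : ∀ e ∈ T.image (chord m v), ∀ f ∈ T.image (chord m v),
      e ≠ f → ¬ Cross m e f) : NatNonCrossing m T := by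
  have : NeZero m := ⟨by omega⟩
  refine ⟨hT, fun p hp q hq hpq => ?_⟩
  have hp' := (hT p hp).mem
  have hq' := (hT q hq).mem
  refine h _ (Finset.mem_image_of_mem _ hp) _ (Finset.mem_image_of_mem _ hq) (fun he => ?_)
    ((cross_chord_iff v hp'.1 hp'.2 hq'.1 hq'.2).2 hpq)
  exact not_natCross_self q (chord_injOn v hp' hq' he ▸ hpq)

lemma isPermissible_image_chord_iff {m : ℕ} (hm : 4 ≤ m) (c : ZMod m → Bool) (v : ZMod m)
    {T : Finset (ℕ × ℕ)} (hT : ∀ p ∈ T, NatDiag m p) :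
    IsPermissible m c (T.image (chord m v)) ↔ NatPermissible m (fun i => c (v + i)) T := by
  have : NeZero m := ⟨by omega⟩
  constructor
  · rintro ⟨⟨h1, -, h2⟩, h3⟩
    exact ⟨card_image_chord v hT ▸ h1, natNonCrossing_of_image_chord hm v hT h2, fun p hp =>
      (permitted_chord_iff c v p).1 (h3 _ (Finset.mem_image_of_mem _ hp))⟩
  · rintro ⟨h1, ⟨-, h2⟩, h3⟩
    refine ⟨⟨(card_image_chord v hT).trans h1, ?_, ?_⟩, ?_⟩ <;>
      simp only [Finset.forall_mem_image]
    · exact fun p hp => (isDiag_chord_iff hm v (hT p hp).mem.1 (hT p hp).mem.2).2 (hT p hp)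
    · intro p hp q hq _ hpq
      have hp' := (hT p hp).mem
      have hq' := (hT q hq).mem
      exact h2 p hp q hq ((cross_chord_iff v hp'.1 hp'.2 hq'.1 hq'.2).1 hpq)
    · exact fun p hp => (permitted_chord_iff c v p).2 (h3 p hp)

lemma IsPermissible.exists_natPermissible {m : ℕ} (hm : 4 ≤ m) {c : ZMod m → Bool} (v : ZMod m)
    {T : Finset (Sym2 (ZMod m))} (hT : IsPermissible m c T) :
    ∃ U, NatPermissible m (fun i => c (v + i)) U ∧ U.image (chord m v) = T := by
  obtain ⟨U, hU, rfl⟩ := exists_image_chord_eq hm v hT.1.2.1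
  exact ⟨U, (isPermissible_image_chord_iff hm c v hU).1 hT, rfl⟩

lemma PermFlipJoined.refl {m : ℕ} {c : ZMod m → Bool} {T : Finset (Sym2 (ZMod m))}
    (hT : IsPermissible m c T) : PermFlipJoined m c T T :=
  ⟨0, fun _ => T, rfl, rfl, fun _ => hT, fun i => i.elim0⟩

lemma PermFlipJoined.head {m : ℕ} {c : ZMod m → Bool} {T U V : Finset (Sym2 (ZMod m))}
    (hT : IsPermissible m c T) (hTU : (T ∩ U).card = m - 4) (h : PermFlipJoined m c U V) :
    PermFlipJoined m c T V := by
  obtain ⟨n, f, rfl, rfl, h1, h2⟩ := h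
  refine ⟨n + 1, Fin.cons T f, rfl, ?_, Fin.cases hT h1, Fin.cases ?_ fun i => ?_⟩
  · rw [← Fin.succ_last, Fin.cons_succ]
  · exact hTU
  · rw [← Fin.succ_castSucc, Fin.cons_succ, Fin.cons_succ]
    exact h2 i

lemma permFlipJoined_of_reflTransGen {m : ℕ} (hm : 4 ≤ m) {c : ZMod m → Bool} (v : ZMod m)
    {T U : Finset (ℕ × ℕ)} (hU : NatPermissible m (fun i => c (v + i)) U)
    (h : Relation.ReflTransGen (NatFlip m fun i => c (v + i)) T U) :
    PermFlipJoined m c (T.image (chord m v)) (U.image (chord m v)) := by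
  induction h using Relation.ReflTransGen.head_induction_on with
  | refl => exact .refl ((isPermissible_image_chord_iff hm c v hU.2.1.1).2 hU)
  | @head T W hTW _ ih =>
    refine ih.head ((isPermissible_image_chord_iff hm c v hTW.1.2.1.1).2 hTW.1) ?_
    rw [← Finset.image_inter_of_injOn, card_image_chord v, hTW.2.2]
    · exact fun p hp => hTW.1.2.1.1 p (Finset.mem_inter.1 hp).1
    · refine (chord_injOn v).mono ?_
      rintro p (hp | hp)
      exacts [(hTW.1.2.1.1 p hp).mem, (hTW.2.1.2.1.1 p hp).mem]

/-- For any non-trivial bicolouring of `P_m` (`m ≥ 4`), the complex of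
permitted diagonals is an `(m-4)`-pseudo-manifold with boundary:
(i) every set of pairwise non-crossing permitted diagonals is contained in a set of
`m - 3` pairwise non-crossing permitted diagonals (a permissible triangulation);
(ii) any two permissible triangulations are joined by a sequence of permissible
triangulations in which consecutive ones share exactly `m - 4` diagonals;
(iii) every set of `m - 4` pairwise non-crossing permitted diagonals is contained in at
most two permissible triangulations. -/
theorem permitted_complex_pseudomanifold (m : ℕ) (hm : 4 ≤ m) (c : ZMod m → Bool)
    (hc : IsNontrivialBicolouring m c) :
    (∀ S : Finset (Sym2 (ZMod m)),
        (∀ e ∈ S, IsDiag m e ∧ Permitted m c e) →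
        (∀ e ∈ S, ∀ f ∈ S, e ≠ f → ¬ Cross m e f) →
        ∃ T : Finset (Sym2 (ZMod m)), IsPermissible m c T ∧ S ⊆ T) ∧
    (∀ T₁ T₂ : Finset (Sym2 (ZMod m)),
        IsPermissible m c T₁ → IsPermissible m c T₂ → PermFlipJoined m c T₁ T₂) ∧
    (∀ S : Finset (Sym2 (ZMod m)), S.card = m - 4 →
        (∀ e ∈ S, IsDiag m e ∧ Permitted m c e) →
        (∀ e ∈ S, ∀ f ∈ S, e ≠ f → ¬ Cross m e f) →
        ∀ T₁ T₂ T₃ : Finset (Sym2 (ZMod m)),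
          IsPermissible m c T₁ → S ⊆ T₁ →
          IsPermissible m c T₂ → S ⊆ T₂ →
          IsPermissible m c T₃ → S ⊆ T₃ →
          T₁ = T₂ ∨ T₁ = T₃ ∨ T₂ = T₃) := by
  obtain ⟨⟨⟨v, hv⟩, -⟩, -⟩ := hc
  have hv0 : (fun i : ℕ => c (v + i)) 0 = true := by simpa using hv
  refine ⟨fun S hS hcross => ?_, fun T₁ T₂ h₁ h₂ => ?_,
    fun S hcard hS hcross T₁ T₂ T₃ h₁ hS₁ h₂ hS₂ h₃ hS₃ => ?_⟩
  · obtain ⟨U, hU, rfl⟩ := exists_image_chord_eq hm v fun e he => (hS e he).1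
    obtain ⟨T, hT, hUT⟩ := exists_natPermissible_superset hm hv0
      (natNonCrossing_of_image_chord hm v hU hcross) fun p hp =>
        (permitted_chord_iff c v p).1 (hS _ (Finset.mem_image_of_mem _ hp)).2
    exact ⟨T.image (chord m v), (isPermissible_image_chord_iff hm c v hT.2.1.1).2 hT,
      Finset.image_subset_image hUT⟩
  · obtain ⟨U₁, hU₁, rfl⟩ := h₁.exists_natPermissible hm v
    obtain ⟨U₂, hU₂, rfl⟩ := h₂.exists_natPermissible hm v
    exact permFlipJoined_of_reflTransGen hm v hU₂ (hU₁.reflTransGen hm hv0 hU₂)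
  · obtain ⟨U, hU, rfl⟩ := exists_image_chord_eq hm v fun e he => (hS e he).1
    obtain ⟨U₁, hU₁, rfl⟩ := h₁.exists_natPermissible hm v
    obtain ⟨U₂, hU₂, rfl⟩ := h₂.exists_natPermissible hm v
    obtain ⟨U₃, hU₃, rfl⟩ := h₃.exists_natPermissible hm v
    have hsub : ∀ W : Finset (ℕ × ℕ), NatPermissible m (fun i => c (v + i)) W →
        U.image (chord m v) ⊆ W.image (chord m v) → U ⊆ W := by
      intro W hW h p hp
      obtain ⟨q, hq, hqp⟩ := Finset.mem_image.1 (h (Finset.mem_image_of_mem _ hp))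
      exact chord_injOn v (hW.2.1.1 q hq).mem (hU p hp).mem hqp ▸ hq
    rw [card_image_chord v hU] at hcard
    rcases natPermissible_eq_or_eq_or_eq hm hcard hU₁ (hsub _ hU₁ hS₁) hU₂ (hsub _ hU₂ hS₂)
      hU₃ (hsub _ hU₃ hS₃) with rfl | rfl | rfl <;> simp

end Poly
end
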